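/- arXiv:2508.12789 — 2 statements merged into one kernel-verified Lean document; each statement's English description precedes it below -/
import Mathlib

section
/- For every integer n ≥ 21 and every integer t satisfying n² + 2n − 11 ≤ 8t ≤ n² + 4n − 16 (i.e., n²/8 + n/4 − 11/8 ≤ t ≤ n²/8 + n/2 − 2), there exists a saturated blocker of the convex n-gon consisting of exactly t edges. -/
open Finset

namespace ConvexBlocker

/-- `c` lies strictly inside the (positively oriented) open arc from `a` to `b`. -/
def Btw (n : ℕ) (a c b : ZMod n) : Prop :=
  0 < (c - a).val ∧ (c - a).val < (b - a).val

/-- Two edges of the convex `n`-gon cross: their endpoints are four pairwise distinct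
vertices which interleave in the cyclic order. -/
def Cross (n : ℕ) (e f : Sym2 (ZMod n)) : Prop :=
  ∃ a b c d : ZMod n, e = s(a, b) ∧ f = s(c, d) ∧
    0 < (c - a).val ∧ (c - a).val < (b - a).val ∧ (b - a).val < (d - a).val

/-- `e` is an edge (an unordered pair of distinct vertices) of the `n`-gon. -/
def IsEdge (n : ℕ) (e : Sym2 (ZMod n)) : Prop :=
  ∃ a b : ZMod n, e = s(a, b) ∧ a ≠ b

/-- `e` is a diagonal of the convex `n`-gon: an edge of order at least 2, i.e. both open
arcs between its endpoints are nonempty. -/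
def IsDiagonal (n : ℕ) (e : Sym2 (ZMod n)) : Prop :=
  ∃ a b : ZMod n, e = s(a, b) ∧ a ≠ b ∧ (∃ c, Btw n a c b) ∧ (∃ d, Btw n b d a)

/-- A triangulation of the convex `n`-gon: an inclusion-maximal set of pairwise
non-crossing diagonals. -/
def IsTriangulation (n : ℕ) (T : Finset (Sym2 (ZMod n))) : Prop :=
  (∀ e ∈ T, IsDiagonal n e) ∧
  (∀ e ∈ T, ∀ f ∈ T, ¬ Cross n e f) ∧
  (∀ e, IsDiagonal n e → e ∉ T → ∃ f ∈ T, Cross n e f)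

/-- A blocker of the convex `n`-gon: a set of edges meeting every triangulation. -/
def IsBlocker (n : ℕ) (B : Finset (Sym2 (ZMod n))) : Prop :=
  (∀ e ∈ B, IsEdge n e) ∧
  ∀ T : Finset (Sym2 (ZMod n)), IsTriangulation n T → (B ∩ T).Nonempty

/-- A saturated blocker of the convex `n`-gon. -/
def IsSaturatedBlocker (n : ℕ) (B : Finset (Sym2 (ZMod n))) : Prop :=
  IsBlocker n B ∧ ∀ e ∈ B, ¬ IsBlocker n (B.erase e)

/-- `e` is an edge of the sub-polygon on the vertex set `S`. -/
def IsEdgeOn (n : ℕ) (S : Finset (ZMod n)) (e : Sym2 (ZMod n)) : Prop :=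
  ∃ a b : ZMod n, e = s(a, b) ∧ a ∈ S ∧ b ∈ S ∧ a ≠ b

/-- `e` is a diagonal of the sub-polygon on `S` (with the inherited cyclic order):
its endpoints are distinct members of `S` which are not cyclically consecutive in `S`. -/
def IsDiagonalOn (n : ℕ) (S : Finset (ZMod n)) (e : Sym2 (ZMod n)) : Prop :=
  ∃ a b : ZMod n, e = s(a, b) ∧ a ∈ S ∧ b ∈ S ∧ a ≠ b ∧
    (∃ c ∈ S, Btw n a c b) ∧ (∃ d ∈ S, Btw n b d a)

/-- A triangulation of the sub-polygon on `S`. -/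
def IsTriangulationOn (n : ℕ) (S : Finset (ZMod n)) (T : Finset (Sym2 (ZMod n))) : Prop :=
  (∀ e ∈ T, IsDiagonalOn n S e) ∧
  (∀ e ∈ T, ∀ f ∈ T, ¬ Cross n e f) ∧
  (∀ e, IsDiagonalOn n S e → e ∉ T → ∃ f ∈ T, Cross n e f)

/-- A blocker of the sub-polygon on `S`. -/
def IsBlockerOn (n : ℕ) (S : Finset (ZMod n)) (B : Finset (Sym2 (ZMod n))) : Prop :=
  (∀ e ∈ B, IsEdgeOn n S e) ∧
  ∀ T : Finset (Sym2 (ZMod n)), IsTriangulationOn n S T → (B ∩ T).Nonempty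

/-- A saturated blocker of the sub-polygon on `S`. -/
def IsSaturatedBlockerOn (n : ℕ) (S : Finset (ZMod n)) (B : Finset (Sym2 (ZMod n))) : Prop :=
  IsBlockerOn n S B ∧ ∀ e ∈ B, ¬ IsBlockerOn n S (B.erase e)

/-- The degree of the vertex `v` in the set of edges `B`. -/
noncomputable def degB (n : ℕ) (B : Finset (Sym2 (ZMod n))) (v : ZMod n) : ℕ :=
  (B.filter (fun e => v ∈ e)).card

end ConvexBlocker

namespace ConvexBlocker

section Coordinates

variable {n : ℕ}

/-- The edge of the `n`-gon joining the vertices with representatives `a` and `b`. -/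
def edge (n a b : ℕ) : Sym2 (ZMod n) := s((a : ZMod n), (b : ZMod n))

theorem val_natCast_sub {a c : ℕ} (ha : a < n) (hc : c < n) :
    ((c : ZMod n) - (a : ZMod n)).val = if a ≤ c then c - a else n + c - a := by
  split_ifs with h
  · rw [← Nat.cast_sub h, ZMod.val_natCast, Nat.mod_eq_of_lt (by omega)]
  · have : (c : ZMod n) - (a : ZMod n) = ((n + c - a : ℕ) : ZMod n) := by
      rw [Nat.cast_sub (by omega)]
      simp
    rw [this, ZMod.val_natCast, Nat.mod_eq_of_lt (by omega)]

theorem exists_natCast_eq (hn : 0 < n) (x : ZMod n) : ∃ a < n, (a : ZMod n) = x := by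
  have : NeZero n := ⟨hn.ne'⟩
  exact ⟨x.val, x.val_lt, ZMod.natCast_zmod_val x⟩

theorem natCast_inj {a b : ℕ} (ha : a < n) (hb : b < n) (h : (a : ZMod n) = b) : a = b := by
  have := (ZMod.natCast_eq_natCast_iff' a b n).1 h
  rwa [Nat.mod_eq_of_lt ha, Nat.mod_eq_of_lt hb] at this

theorem edge_eq_iff {a b c d : ℕ} (ha : a < n) (hb : b < n) (hc : c < n) (hd : d < n) :
    edge n a b = edge n c d ↔ a = c ∧ b = d ∨ a = d ∧ b = c := by
  have key : ∀ {x y : ℕ}, x < n → y < n → ((x : ZMod n) = y ↔ x = y) :=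
    fun hx hy => ⟨natCast_inj hx hy, fun h => by rw [h]⟩
  rw [edge, edge, Sym2.eq_iff, key ha hc, key hb hd, key ha hd, key hb hc]

theorem edge_inj {a b c d : ℕ} (hab : a < b) (hb : b < n) (hcd : c < d) (hd : d < n) :
    edge n a b = edge n c d ↔ a = c ∧ b = d := by
  rw [edge_eq_iff (by omega) hb (by omega) hd]
  omega

theorem cross_edge_iff {a b c d : ℕ} (hab : a < b) (hb : b < n) (hcd : c < d) (hd : d < n) :
    Cross n (edge n a b) (edge n c d) ↔
      (a < c ∧ c < b ∧ b < d) ∨ (c < a ∧ a < d ∧ d < b) := by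
  have ha : a < n := by omega
  have hc : c < n := by omega
  constructor
  · rintro ⟨a', b', c', d', he, hf, h1, h2, h3⟩
    obtain ⟨a', ha', rfl⟩ := exists_natCast_eq (by omega) a'
    obtain ⟨b', hb', rfl⟩ := exists_natCast_eq (by omega) b'
    obtain ⟨c', hc', rfl⟩ := exists_natCast_eq (by omega) c'
    obtain ⟨d', hd', rfl⟩ := exists_natCast_eq (by omega) d'
    rw [val_natCast_sub ha' hc'] at h1 h2
    rw [val_natCast_sub ha' hb'] at h2 h3
    rw [val_natCast_sub ha' hd'] at h3
    have he' := (edge_eq_iff ha hb ha' hb').1 he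
    have hf' := (edge_eq_iff hc hd hc' hd').1 hf
    clear he hf
    split_ifs at * <;> omega
  · rintro (h | h)
    · refine ⟨a, b, c, d, rfl, rfl, ?_⟩
      rw [val_natCast_sub ha hc, val_natCast_sub ha hb, val_natCast_sub ha hd]
      split_ifs <;> omega
    · refine ⟨a, b, d, c, rfl, Sym2.eq_swap, ?_⟩
      rw [val_natCast_sub ha hc, val_natCast_sub ha hb, val_natCast_sub ha hd]
      split_ifs <;> omega

theorem btw_natCast_iff {a b c : ℕ} (ha : a < n) (hb : b < n) (hc : c < n) :
    Btw n (a : ZMod n) c b ↔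
      (a < c ∧ c < b) ∨ (c < b ∧ b < a) ∨ (b < a ∧ a < c) := by
  rw [Btw, val_natCast_sub ha hc, val_natCast_sub ha hb]
  split_ifs <;> omega

theorem exists_btw_natCast_iff {a b : ℕ} (ha : a < n) (hb : b < n) :
    (∃ c, Btw n (a : ZMod n) c b) ↔ a + 2 ≤ b ∨ (b < a ∧ (0 < b ∨ a + 1 < n)) := by
  constructor
  · rintro ⟨c, hc⟩
    obtain ⟨c, hc', rfl⟩ := exists_natCast_eq (by omega) c
    rw [btw_natCast_iff ha hb hc'] at hc
    omega
  · intro h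
    obtain ⟨c, hc, h⟩ : ∃ c < n, (a < c ∧ c < b) ∨ (c < b ∧ b < a) ∨ (b < a ∧ a < c) := by
      rcases h with h | ⟨h, h' | h'⟩
      · exact ⟨a + 1, by omega⟩
      · exact ⟨0, by omega⟩
      · exact ⟨a + 1, by omega⟩
    exact ⟨c, (btw_natCast_iff ha hb hc).2 h⟩

theorem isDiagonal_edge_iff {a b : ℕ} (hab : a < b) (hb : b < n) :
    IsDiagonal n (edge n a b) ↔ a + 2 ≤ b ∧ (0 < a ∨ b + 1 < n) := by
  have ha : a < n := by omega
  constructor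
  · rintro ⟨a', b', he, -, h1, h2⟩
    obtain ⟨a', ha', rfl⟩ := exists_natCast_eq (by omega) a'
    obtain ⟨b', hb', rfl⟩ := exists_natCast_eq (by omega) b'
    rw [exists_btw_natCast_iff ha' hb'] at h1
    rw [exists_btw_natCast_iff hb' ha'] at h2
    have he' := (edge_eq_iff ha hb ha' hb').1 he
    omega
  · intro h
    refine ⟨a, b, rfl, fun h' => ?_, ?_, ?_⟩
    · have := natCast_inj ha hb h'
      omega
    · rw [exists_btw_natCast_iff ha hb]
      omega
    · rw [exists_btw_natCast_iff hb ha]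
      omega

theorem IsDiagonal.exists_edge (hn : 0 < n) {e : Sym2 (ZMod n)} (he : IsDiagonal n e) :
    ∃ a b, a < b ∧ b < n ∧ e = edge n a b := by
  obtain ⟨a, b, rfl, hne, -⟩ := he
  obtain ⟨a, ha, rfl⟩ := exists_natCast_eq hn a
  obtain ⟨b, hb, rfl⟩ := exists_natCast_eq hn b
  rcases lt_trichotomy a b with h | rfl | h
  · exact ⟨a, b, h, hb, rfl⟩
  · exact absurd rfl hne
  · exact ⟨b, a, h, ha, Sym2.eq_swap⟩

/-- The set of edges of the `n`-gon whose representatives are the pairs in `P`. -/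
def edgeSet (n : ℕ) (P : Finset (ℕ × ℕ)) : Finset (Sym2 (ZMod n)) :=
  P.image fun x => edge n x.1 x.2

theorem edge_mem_edgeSet {P : Finset (ℕ × ℕ)} (hP : ∀ x ∈ P, x.1 < x.2 ∧ x.2 < n) {a b : ℕ}
    (hab : a < b) (hb : b < n) : edge n a b ∈ edgeSet n P ↔ (a, b) ∈ P := by
  constructor
  · intro h
    obtain ⟨x, hx, he⟩ := Finset.mem_image.1 h
    obtain ⟨h1, h2⟩ := (edge_inj (hP x hx).1 (hP x hx).2 hab hb).1 he
    rw [← h1, ← h2]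
    exact hx
  · exact fun h => Finset.mem_image.2 ⟨(a, b), h, rfl⟩

theorem card_edgeSet {P : Finset (ℕ × ℕ)} (hP : ∀ x ∈ P, x.1 < x.2 ∧ x.2 < n) :
    (edgeSet n P).card = P.card := by
  refine Finset.card_image_of_injOn fun x hx y hy h => ?_
  obtain ⟨h1, h2⟩ := (edge_inj (hP x hx).1 (hP x hx).2 (hP y hy).1 (hP y hy).2).1 h
  exact Prod.ext h1 h2

theorem isTriangulation_edgeSet (hn : 0 < n) {P : Finset (ℕ × ℕ)}
    (hdiag : ∀ a b, (a, b) ∈ P → a + 2 ≤ b ∧ b < n ∧ (0 < a ∨ b + 1 < n))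
    (hcross : ∀ a b c d, (a, b) ∈ P → (c, d) ∈ P → ¬(a < c ∧ c < b ∧ b < d))
    (hmax : ∀ a b, a + 2 ≤ b → b < n → (0 < a ∨ b + 1 < n) → (a, b) ∉ P →
      ∃ c d, (c, d) ∈ P ∧ ((a < c ∧ c < b ∧ b < d) ∨ (c < a ∧ a < d ∧ d < b))) :
    IsTriangulation n (edgeSet n P) := by
  have hP : ∀ x ∈ P, x.1 < x.2 ∧ x.2 < n := fun x hx => by
    have := hdiag x.1 x.2 hx
    omega
  refine ⟨fun e he => ?_, fun e he f hf => ?_, fun e he heP => ?_⟩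
  · obtain ⟨⟨a, b⟩, hx, rfl⟩ := Finset.mem_image.1 he
    have := hdiag a b hx
    exact (isDiagonal_edge_iff (by omega) (by omega)).2 ⟨this.1, this.2.2⟩
  · obtain ⟨⟨a, b⟩, hx, rfl⟩ := Finset.mem_image.1 he
    obtain ⟨⟨c, d⟩, hy, rfl⟩ := Finset.mem_image.1 hf
    rw [cross_edge_iff (hP _ hx).1 (hP _ hx).2 (hP _ hy).1 (hP _ hy).2]
    rintro (h | h)
    · exact hcross a b c d hx hy h
    · exact hcross c d a b hy hx h
  · obtain ⟨a, b, hab, hb, rfl⟩ := he.exists_edge hn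
    obtain ⟨h1, h2⟩ := (isDiagonal_edge_iff hab hb).1 he
    rw [edge_mem_edgeSet hP hab hb] at heP
    obtain ⟨c, d, hcd, h⟩ := hmax a b h1 hb h2 heP
    have := hdiag c d hcd
    exact ⟨edge n c d, (edge_mem_edgeSet hP (by omega) (by omega)).2 hcd,
      (cross_edge_iff hab hb (by omega) (by omega)).2 h⟩

end Coordinates

section Fans

variable {n i j u v w : ℕ}

/-- The pairs `a < b` for which `{a, b}` is the chord `{lo, hi}` or a chord of
`lo, …, hi` through `c`. -/
def FanChord (lo hi c a b : ℕ) : Prop :=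
  lo ≤ a ∧ b ≤ hi ∧ (a = c ∨ b = c ∨ (a = lo ∧ b = hi))

open Classical in
/-- The triangulation in which the vertex `0` is joined to `i` and `j`, while the polygons on
`1, …, i`, on `i, …, j` and on `j, …, n - 1` are fans with centres `u`, `v` and `w`. -/
noncomputable def threeFans (n i j u v w : ℕ) : Finset (ℕ × ℕ) :=
  (range n ×ˢ range n).filter fun x =>
    x.1 + 2 ≤ x.2 ∧ (0 < x.1 ∨ x.2 + 1 < n) ∧
      ((x.1 = 0 ∧ (x.2 = i ∨ x.2 = j)) ∨ FanChord 1 i u x.1 x.2 ∨ FanChord i j v x.1 x.2 ∨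
        FanChord j (n - 1) w x.1 x.2)

theorem mem_threeFans {a b : ℕ} : (a, b) ∈ threeFans n i j u v w ↔
    a + 2 ≤ b ∧ b < n ∧ (0 < a ∨ b + 1 < n) ∧
      ((a = 0 ∧ (b = i ∨ b = j)) ∨ FanChord 1 i u a b ∨ FanChord i j v a b ∨
        FanChord j (n - 1) w a b) := by
  simp only [threeFans, Finset.mem_filter, Finset.mem_product, Finset.mem_range]
  constructor
  · rintro ⟨⟨-, h1⟩, h2, h3, h4⟩
    exact ⟨h2, h1, h3, h4⟩
  · rintro ⟨h2, h1, h3, h4⟩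
    exact ⟨⟨by omega, h1⟩, h2, h3, h4⟩

/-- A chord of `lo, …, hi` outside the fan with centre `c` crosses a chord of that fan. -/
theorem exists_fanChord_cross {lo hi c a b : ℕ} (hc : lo ≤ c) (hc' : c ≤ hi) (ha : lo ≤ a)
    (hb : b ≤ hi) (hab : a + 2 ≤ b) (h : ¬FanChord lo hi c a b) :
    ∃ a' b', FanChord lo hi c a' b' ∧ a' + 2 ≤ b' ∧
      ((a < a' ∧ a' < b ∧ b < b') ∨ (a' < a ∧ a < b' ∧ b' < b)) := by
  unfold FanChord at h ⊢
  rcases lt_trichotomy c a with hca | hca | hca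
  · exact ⟨c, a + 1, by omega⟩
  · omega
  rcases lt_trichotomy c b with hcb | hcb | hcb
  · by_cases hlo : lo < a
    · exact ⟨lo, c, by omega⟩
    · exact ⟨c, hi, by omega⟩
  · omega
  · exact ⟨b - 1, c, by omega⟩

theorem isTriangulation_threeFans (hn : 4 ≤ n) (hu : 1 ≤ u) (hui : u ≤ i) (hiv : i ≤ v)
    (hvj : v ≤ j) (hjw : j ≤ w) (hw : w < n) :
    IsTriangulation n (edgeSet n (threeFans n i j u v w)) := by
  refine isTriangulation_edgeSet (by omega) (fun a b h => ?_) (fun a b c d h h' => ?_)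
    (fun a b hab hb h0 h => ?_)
  · obtain ⟨h1, h2, h3, -⟩ := mem_threeFans.1 h
    exact ⟨h1, h2, h3⟩
  · obtain ⟨h1, h2, h3, h4⟩ := mem_threeFans.1 h
    obtain ⟨h1', h2', h3', h4'⟩ := mem_threeFans.1 h'
    clear h h'
    unfold FanChord at h4 h4'
    rcases h4 with h4 | h4 | h4 | h4 <;> rcases h4' with h4' | h4' | h4' | h4' <;> omega
  · have inFan : ∀ lo hi c, 1 ≤ lo → lo ≤ c → c ≤ hi → hi < n → lo ≤ a → b ≤ hi →
        (∀ a' b', FanChord lo hi c a' b' → a' + 2 ≤ b' → (a', b') ∈ threeFans n i j u v w) →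
        ∃ c d, (c, d) ∈ threeFans n i j u v w ∧
          ((a < c ∧ c < b ∧ b < d) ∨ (c < a ∧ a < d ∧ d < b)) := by
      intro lo hi c h1 h2 h3 h4 h5 h6 h7
      obtain ⟨a', b', h8, h9, h10⟩ :=
        exists_fanChord_cross h2 h3 h5 h6 hab fun h8 => h (h7 a b h8 hab)
      exact ⟨a', b', h7 a' b' h8 h9, h10⟩
    rcases Nat.eq_zero_or_pos a with rfl | ha
    · have hb' : b ≠ i ∧ b ≠ j := by
        constructor <;> rintro rfl <;> exact h (mem_threeFans.2 ⟨hab, hb, h0, by simp⟩)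
      rcases lt_or_ge b i with hbi | hbi
      · exact ⟨1, i, mem_threeFans.2 (by unfold FanChord; omega), by omega⟩
      rcases lt_or_ge b j with hbj | hbj
      · exact ⟨i, j, mem_threeFans.2 (by unfold FanChord; omega), by omega⟩
      · exact ⟨j, n - 1, mem_threeFans.2 (by unfold FanChord; omega), by omega⟩
    by_cases hi : a < i ∧ i < b
    · exact ⟨0, i, mem_threeFans.2 (by unfold FanChord; omega), by omega⟩
    by_cases hj : a < j ∧ j < b
    · exact ⟨0, j, mem_threeFans.2 (by unfold FanChord; omega), by omega⟩
    rcases le_or_gt b i with hbi | hbi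
    · refine inFan 1 i u (by omega) hu hui (by omega) ha hbi fun a' b' h1 h2 =>
        mem_threeFans.2 ⟨h2, ?_, ?_, Or.inr (Or.inl h1)⟩ <;> unfold FanChord at h1 <;> omega
    rcases le_or_gt b j with hbj | hbj
    · refine inFan i j v (by omega) hiv hvj (by omega) (by omega) hbj fun a' b' h1 h2 =>
        mem_threeFans.2 ⟨h2, ?_, ?_, Or.inr (Or.inr (Or.inl h1))⟩ <;>
        unfold FanChord at h1 <;> omega
    · refine inFan j (n - 1) w (by omega) hjw (by omega) (by omega) (by omega) (by omega)
        fun a' b' h1 h2 =>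
        mem_threeFans.2 ⟨h2, ?_, ?_, Or.inr (Or.inr (Or.inr h1))⟩ <;>
        unfold FanChord at h1 <;> omega

end Fans

/-- The vertices `1, …, n - 1` are split into left vertices, right vertices and neutral vertices
(those which are neither), so that `1` is left, `n - 1` is right, and no left vertex is
immediately followed by a right one. -/
structure IsLabelling (n : ℕ) (L R : ℕ → Prop) : Prop where
  disjoint : ∀ i, L i → ¬R i
  first : L 1
  last : R (n - 1)
  gap : ∀ i, L i → ¬R (i + 1)

open Classical in
/-- The pairs joining `0` to a neutral vertex, or a left vertex to a later right vertex. -/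
noncomputable def labelPairs (n : ℕ) (L R : ℕ → Prop) : Finset (ℕ × ℕ) :=
  (range n ×ˢ range n).filter fun x =>
    x.1 < x.2 ∧ ((x.1 = 0 ∧ ¬L x.2 ∧ ¬R x.2) ∨ (0 < x.1 ∧ L x.1 ∧ R x.2))

section Labelling

variable {n : ℕ} {L R : ℕ → Prop}

theorem mem_labelPairs {a b : ℕ} : (a, b) ∈ labelPairs n L R ↔
    a < b ∧ b < n ∧ ((a = 0 ∧ ¬L b ∧ ¬R b) ∨ (0 < a ∧ L a ∧ R b)) := by
  simp only [labelPairs, Finset.mem_filter, Finset.mem_product, Finset.mem_range]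
  constructor
  · rintro ⟨⟨-, h1⟩, h2, h3⟩
    exact ⟨h2, h1, h3⟩
  · rintro ⟨h2, h1, h3⟩
    exact ⟨⟨by omega, h1⟩, h2, h3⟩

theorem labelPairs_lt (x : ℕ × ℕ) (hx : x ∈ labelPairs n L R) : x.1 < x.2 ∧ x.2 < n := by
  obtain ⟨h1, h2, -⟩ := mem_labelPairs.1 hx
  exact ⟨h1, h2⟩

/-- Between a left vertex and a later right vertex there is a neutral vertex. -/
theorem IsLabelling.exists_neutral (h : IsLabelling n L R) {i j : ℕ} (hij : i ≤ j) (hi : L i)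
    (hj : R j) : ∃ k, i ≤ k ∧ k ≤ j ∧ ¬L k ∧ ¬R k := by
  by_contra! hk
  have key : ∀ m, i ≤ m → m ≤ j → L m := by
    intro m him
    induction m, him using Nat.le_induction with
    | base => exact fun _ => hi
    | succ m him ih =>
      intro hm
      by_contra hL
      exact h.gap m (ih (by omega)) (hk (m + 1) (by omega) hm hL)
  exact h.disjoint j (key j hij le_rfl) hj

theorem IsLabelling.isBlocker (hn : 4 ≤ n) (h : IsLabelling n L R) :
    IsBlocker n (edgeSet n (labelPairs n L R)) := by
  classical
  refine ⟨fun e he => ?_, fun T hT => ?_⟩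
  · obtain ⟨⟨a, b⟩, hx, rfl⟩ := Finset.mem_image.1 he
    obtain ⟨h1, h2⟩ := labelPairs_lt _ hx
    refine ⟨a, b, rfl, fun h' => ?_⟩
    have := natCast_inj (h1.trans h2) h2 h'
    omega
  obtain ⟨hdiag, hcross, hmax⟩ := hT
  by_contra hne
  have havoid : ∀ a b, (a, b) ∈ labelPairs n L R → edge n a b ∉ T := fun a b hab hT' =>
    hne ⟨edge n a b, Finset.mem_inter.2
      ⟨Finset.mem_image.2 ⟨(a, b), hab, rfl⟩, hT'⟩⟩
  let N : ℕ → Prop := fun k => k = 1 ∨ k = n - 1 ∨ edge n 0 k ∈ T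
  -- `i` is the last left neighbour of `0`, and `j` is the neighbour of `0` after `i`.
  let i := Nat.findGreatest (fun k => N k ∧ L k) (n - 1)
  have hi : N i ∧ L i :=
    Nat.findGreatest_spec (P := fun k => N k ∧ L k) (m := 1) (by omega) ⟨Or.inl rfl, h.first⟩
  have hi1 : 1 ≤ i :=
    Nat.le_findGreatest (P := fun k => N k ∧ L k) (by omega) ⟨Or.inl rfl, h.first⟩
  have hin : i < n - 1 := by
    refine lt_of_le_of_ne (Nat.findGreatest_le _) fun h' => h.disjoint i hi.2 ?_
    rw [h']
    exact h.last
  have hex : ∃ k, i < k ∧ N k := ⟨n - 1, hin, Or.inr (Or.inl rfl)⟩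
  let j := Nat.find hex
  obtain ⟨hij, hj⟩ : i < j ∧ N j := Nat.find_spec hex
  have hjn : j ≤ n - 1 := Nat.find_min' hex ⟨hin, Or.inr (Or.inl rfl)⟩
  have hbetween : ∀ k, i < k → k < j → ¬N k := fun k hik hkj hk =>
    Nat.find_min hex hkj ⟨hik, hk⟩
  have hjL : ¬L j := fun hL =>
    Nat.findGreatest_is_greatest (P := fun k => N k ∧ L k) hij hjn ⟨hj, hL⟩
  have hjR : R j := by
    by_contra hR
    rcases hj with hj | hj | hj
    · omega
    · exact hR (hj ▸ h.last)
    · exact havoid 0 j (mem_labelPairs.2 ⟨by omega, by omega, Or.inl ⟨rfl, hjL, hR⟩⟩) hj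
  have hgap : j ≠ i + 1 := fun h' => h.gap i hi.2 (h' ▸ hjR)
  have hijT : edge n i j ∉ T :=
    havoid i j (mem_labelPairs.2 ⟨hij, by omega, Or.inr ⟨by omega, hi.2, hjR⟩⟩)
  obtain ⟨f, hfT, hf⟩ := hmax _
    ((isDiagonal_edge_iff hij (by omega)).2 ⟨by omega, Or.inl (by omega)⟩) hijT
  obtain ⟨c, d, hcd, hd, rfl⟩ := (hdiag f hfT).exists_edge (by omega)
  rw [cross_edge_iff hij (by omega) hcd hd] at hf
  have crossFree : ∀ k, 1 ≤ k → k < n → N k → c < k → k < d → c = 0 := by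
    intro k hk hkn hNk hck hkd
    by_contra hc
    rcases hNk with hNk | hNk | hNk
    · omega
    · omega
    · exact hcross _ hNk _ hfT
        ((cross_edge_iff (by omega) hkn hcd hd).2 (Or.inl ⟨by omega, hck, hkd⟩))
  rcases hf with hf | hf
  · have := crossFree j (by omega) (by omega) hj hf.2.1 hf.2.2
    omega
  · have hc := crossFree i hi1 (by omega) hi.1 hf.1 hf.2.1
    subst hc
    exact hbetween d hf.2.1 hf.2.2 (Or.inr (Or.inr hfT))

/-- Removing a pair which is the only one shared with some triangulation destroys the blocker. -/
theorem not_isBlocker_erase {P Q : Finset (ℕ × ℕ)} {a b : ℕ}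
    (hP : ∀ x ∈ P, x.1 < x.2 ∧ x.2 < n) (hQ : ∀ x ∈ Q, x.1 < x.2 ∧ x.2 < n)
    (hT : IsTriangulation n (edgeSet n Q))
    (honly : ∀ c d, (c, d) ∈ P → (c, d) ∈ Q → c = a ∧ d = b) :
    ¬IsBlocker n ((edgeSet n P).erase (edge n a b)) := by
  rintro ⟨-, hB⟩
  obtain ⟨e, he⟩ := hB _ hT
  obtain ⟨he1, he2⟩ := Finset.mem_inter.1 he
  obtain ⟨hne, he1⟩ := Finset.mem_erase.1 he1
  obtain ⟨⟨c, d⟩, hx, rfl⟩ := Finset.mem_image.1 he2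
  obtain ⟨rfl, rfl⟩ := honly c d
    ((edge_mem_edgeSet hP (hQ _ hx).1 (hQ _ hx).2).1 he1) hx
  exact hne rfl

theorem IsLabelling.isSaturatedBlocker (hn : 4 ≤ n) (h : IsLabelling n L R) :
    IsSaturatedBlocker n (edgeSet n (labelPairs n L R)) := by
  refine ⟨h.isBlocker hn, fun e he => ?_⟩
  obtain ⟨⟨a, b⟩, hx, rfl⟩ := Finset.mem_image.1 he
  have reduce : ∀ i j u v w, 1 ≤ u → u ≤ i → i ≤ v → v ≤ j → j ≤ w → w < n →
      (∀ c d, (c, d) ∈ labelPairs n L R → (c, d) ∈ threeFans n i j u v w → c = a ∧ d = b) →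
      ¬IsBlocker n ((edgeSet n (labelPairs n L R)).erase (edge n a b)) := by
    intro i j u v w h1 h2 h3 h4 h5 h6 h7
    refine not_isBlocker_erase labelPairs_lt (fun x hx => ?_)
      (isTriangulation_threeFans hn h1 h2 h3 h4 h5 h6) h7
    have := mem_threeFans.1 hx
    omega
  obtain ⟨hab, hb, ⟨rfl, hbL, hbR⟩ | ⟨ha, haL, hbR⟩⟩ := mem_labelPairs.1 hx
  · refine reduce b b b b b (by omega) le_rfl le_rfl le_rfl le_rfl hb fun c d h1 h2 => ?_
    obtain ⟨hcd, hd, h1⟩ := mem_labelPairs.1 h1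
    obtain ⟨-, -, -, h2⟩ := mem_threeFans.1 h2
    unfold FanChord at h2
    grind
  · obtain ⟨v, hav, hvb, hvL, hvR⟩ := h.exists_neutral hab.le haL hbR
    -- The outer fans are centred at a neutral vertex, unless all their vertices are alike.
    obtain ⟨u, hu, hua, hu'⟩ : ∃ u, 1 ≤ u ∧ u ≤ a ∧
        ((¬L u ∧ ¬R u) ∨ ∀ k, 1 ≤ k → k ≤ a → ¬R k) := by
      by_cases hk : ∀ k, 1 ≤ k → k ≤ a → ¬R k
      · exact ⟨a, ha, le_rfl, Or.inr hk⟩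
      · push Not at hk
        obtain ⟨k, hk1, hka, hkR⟩ := hk
        obtain ⟨u, hu1, huk, hu⟩ := h.exists_neutral hk1 h.first hkR
        exact ⟨u, hu1, by omega, Or.inl hu⟩
    obtain ⟨w, hw, hbw, hw'⟩ : ∃ w, w < n ∧ b ≤ w ∧
        ((¬L w ∧ ¬R w) ∨ ∀ k, b ≤ k → k < n → ¬L k) := by
      by_cases hk : ∀ k, b ≤ k → k < n → ¬L k
      · exact ⟨b, hb, le_rfl, Or.inr hk⟩
      · push Not at hk
        obtain ⟨k, hkb, hkn, hkL⟩ := hk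
        obtain ⟨w, hkw, hwn, hw⟩ := h.exists_neutral (by omega : k ≤ n - 1) hkL h.last
        exact ⟨w, by omega, by omega, Or.inl hw⟩
    refine reduce a b u v w hu hua hav hvb hbw hw fun c d h1 h2 => ?_
    obtain ⟨hcd, hd, h1⟩ := mem_labelPairs.1 h1
    obtain ⟨-, -, -, h2⟩ := mem_threeFans.1 h2
    have hLR := h.disjoint
    have hfirst := h.first
    have hlast := h.last
    unfold FanChord at h2
    rcases h1 with ⟨rfl, hdL, hdR⟩ | ⟨hc, hcL, hdR⟩
    · grind
    · rcases h2 with h2 | ⟨h2, h3, h4⟩ | ⟨h2, h3, h4⟩ | ⟨h2, h3, h4⟩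
      · omega
      · grind
      · grind
      · grind

end Labelling

/-- The labelling of `1, …, n - 1` by `y` left, `c` neutral, `δ` right, one left, one neutral and
`α` right vertices, in this order. -/
theorem exists_saturatedBlocker_of_blocks {n y c δ α : ℕ} (hy : 1 ≤ y) (hc : 1 ≤ c) (hα : 1 ≤ α)
    (hn : n = y + c + δ + α + 3) :
    ∃ B : Finset (Sym2 (ZMod n)), IsSaturatedBlocker n B ∧
      B.card = y * (δ + α) + α + c + 1 := by
  let L : ℕ → Prop := fun k => (1 ≤ k ∧ k ≤ y) ∨ k = y + c + δ + 1
  let R : ℕ → Prop := fun k => (y + c + 1 ≤ k ∧ k ≤ y + c + δ) ∨ (y + c + δ + 3 ≤ k ∧ k < n)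
  have h : IsLabelling n L R := by
    constructor <;> simp only [L, R] <;> intros <;> omega
  refine ⟨_, h.isSaturatedBlocker (by omega), ?_⟩
  rw [card_edgeSet labelPairs_lt]
  have hpairs : labelPairs n L R =
      ({0} ×ˢ Finset.Icc (y + 1) (y + c) ∪ {(0, y + c + δ + 2)}) ∪
      (Finset.Icc 1 y ×ˢ
        (Finset.Icc (y + c + 1) (y + c + δ) ∪ Finset.Ico (y + c + δ + 3) n) ∪
        {y + c + δ + 1} ×ˢ Finset.Ico (y + c + δ + 3) n) := by
    ext ⟨a, b⟩
    simp only [mem_labelPairs, L, R, Finset.mem_union, Finset.mem_product, Finset.mem_singleton,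
      Finset.mem_Icc, Finset.mem_Ico, Prod.mk.injEq]
    omega
  rw [hpairs, Finset.card_union_of_disjoint, Finset.card_union_of_disjoint,
    Finset.card_union_of_disjoint, Finset.card_product, Finset.card_product, Finset.card_product,
    Finset.card_union_of_disjoint]
  · simp only [Finset.card_singleton, Nat.card_Icc, Nat.card_Ico]
    rw [show y + c + 1 - (y + 1) = c by omega, show y + 1 - 1 = y by omega,
      show y + c + δ + 1 - (y + c + 1) = δ by omega, show n - (y + c + δ + 3) = α by omega]
    ring
  all_goals
    rw [Finset.disjoint_left]
    first
    | intro a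
      simp only [Finset.mem_Icc, Finset.mem_Ico]
      omega
    | rintro ⟨a, b⟩
      simp only [Finset.mem_union, Finset.mem_product, Finset.mem_singleton,
        Finset.mem_Icc, Finset.mem_Ico, Prod.mk.injEq]
      omega

/-- Every size from `n - 2` to `n - 3 + x * (n - 5 - x)` is attained. -/
theorem exists_saturatedBlocker_card {n x s : ℕ} (hx : 0 < x)
    (hs : s < x * (n - 5 - x)) :
    ∃ B : Finset (Sym2 (ZMod n)), IsSaturatedBlocker n B ∧ B.card = n - 2 + s := by
  have hy : s / x < n - 5 - x := Nat.div_lt_of_lt_mul hs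
  have hα : s % x < x := Nat.mod_lt _ hx
  have hdiv := Nat.div_add_mod s x
  generalize s / x = q at *
  generalize s % x = r at *
  obtain ⟨δ, hδ⟩ : ∃ δ, δ + r = x := ⟨x - r, by omega⟩
  obtain ⟨c, hc⟩ : ∃ c, q + x + c + 5 = n := ⟨n - 5 - x - q, by omega⟩
  obtain ⟨B, hB, hcard⟩ := exists_saturatedBlocker_of_blocks (n := n) (y := q + 1)
    (c := c) (δ := δ) (α := r + 1) (by omega) (by omega) (by omega) (by omega)
  refine ⟨B, hB, ?_⟩
  have hmul : (q + 1) * (δ + (r + 1)) = x * q + q + x + 1 := by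
    rw [← add_assoc, hδ]
    ring
  rw [hmul] at hcard
  omega

end ConvexBlocker

open ConvexBlocker in
/-- for every `n ≥ 21` and every `t` with `n² + 2n - 11 ≤ 8t ≤ n² + 4n - 16`,
there is a saturated blocker of the convex `n`-gon with exactly `t` edges. -/
theorem spectrum_gap_range
    (n : ℕ) (hn : 21 ≤ n) (t : ℕ)
    (ht1 : n ^ 2 + 2 * n ≤ 8 * t + 11) (ht2 : 8 * t + 16 ≤ n ^ 2 + 4 * n) :
    ∃ B : Finset (Sym2 (ZMod n)), IsSaturatedBlocker n B ∧ B.card = t := by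
  have hnt : n ≤ t := by nlinarith
  have key : ∀ k, 10 ≤ k → n = 2 * k ∨ n = 2 * k + 1 →
      t - (n - 2) < (k - 3) * (n - 5 - (k - 3)) := by
    intro k hk hnk
    obtain ⟨m, rfl⟩ : ∃ m, k = m + 10 := ⟨k - 10, by omega⟩
    rw [Nat.sub_lt_iff_lt_add' (by omega)]
    rcases hnk with rfl | rfl
    · rw [show 2 * (m + 10) - 2 = 2 * m + 18 by omega,
        show 2 * (m + 10) - 5 - (m + 10 - 3) = m + 8 by omega, show m + 10 - 3 = m + 7 by omega]
      nlinarith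
    · rw [show 2 * (m + 10) + 1 - 2 = 2 * m + 19 by omega,
        show 2 * (m + 10) + 1 - 5 - (m + 10 - 3) = m + 9 by omega,
        show m + 10 - 3 = m + 7 by omega]
      nlinarith
  obtain ⟨B, hB, hcard⟩ := exists_saturatedBlocker_card (n := n) (x := n / 2 - 3)
    (s := t - (n - 2)) (by omega) (key (n / 2) (by omega) (by omega))
  exact ⟨B, hB, by omega⟩
end

section
/- Let n ≥ 5 and let B be a saturated blocker of size n−1 of the convex n-gon. If the ear-cover {i−1,i+1} does not belong to B and deg_B(i) = 2, then B∖{i} is a blocker of the (n−1)-gon C∖{i} with exactly n−3 edges (hence a minimum-sized blocker of the (n−1)-gon). -/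
open Finset

namespace ConvexBlocker

/-- The cyclic distance between two vertices in terms of their positions relative to `w`. -/
lemma val_sub_eq_ite {n : ℕ} [NeZero n] (u v w : ZMod n) :
    (u - v).val = if (v - w).val ≤ (u - w).val then (u - w).val - (v - w).val
      else n + (u - w).val - (v - w).val := by
  have hu := ZMod.val_lt (u - w)
  have hv := ZMod.val_lt (v - w)
  have huv : u - v = (u - w) - (v - w) := by ring
  split_ifs with h
  · rw [huv, ZMod.val_sub h]
  · have hlt : n + (u - w).val - (v - w).val < n := by omega
    rw [← ZMod.val_cast_of_lt hlt, Nat.cast_sub (by omega), huv]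
    simp

lemma eq_iff_val_sub_eq {n : ℕ} [NeZero n] (u v w : ZMod n) :
    u = v ↔ (u - w).val = (v - w).val := by
  rw [(ZMod.val_injective n).eq_iff, sub_left_inj]

lemma val_add_one_sub_self {n : ℕ} (hn : 2 ≤ n) (i : ZMod n) : (i + 1 - i).val = 1 := by
  have : Fact (1 < n) := ⟨hn⟩
  rw [add_sub_cancel_left, ZMod.val_one]

lemma val_sub_one_sub_self {n : ℕ} (hn : 2 ≤ n) (i : ZMod n) : (i - 1 - i).val = n - 1 := by
  have : Fact (1 < n) := ⟨hn⟩
  have : NeZero n := ⟨by omega⟩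
  have h : i - 1 - i = -1 := by ring
  rw [h, ZMod.neg_val, ZMod.val_one]
  simp

/-- An edge crossing the ear-cover of `i` contains `i`. -/
lemma mem_of_cross_earCover {n : ℕ} (hn : 5 ≤ n) {i : ZMod n} {e : Sym2 (ZMod n)}
    (h : Cross n e s(i - 1, i + 1)) : i ∈ e := by
  have : NeZero n := ⟨by omega⟩
  obtain ⟨a, b, c, d, rfl, hcd, h1, h2, h3⟩ := h
  have p := val_add_one_sub_self (by omega : 2 ≤ n) i
  have q := val_sub_one_sub_self (by omega : 2 ≤ n) i
  have ha := ZMod.val_lt (a - i)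
  have hb := ZMod.val_lt (b - i)
  rw [Sym2.mem_iff, eq_iff_val_sub_eq i a i, eq_iff_val_sub_eq i b i, sub_self, ZMod.val_zero]
  rw [val_sub_eq_ite _ a i] at h1 h2 h3
  rw [val_sub_eq_ite _ a i] at h2 h3
  rw [Sym2.eq_iff] at hcd
  rcases hcd with ⟨rfl, rfl⟩ | ⟨rfl, rfl⟩ <;> rw [p, q] at * <;> split_ifs at * <;> omega

lemma cross_symm {n : ℕ} {e f : Sym2 (ZMod n)} (hn : n ≠ 0) (h : Cross n e f) : Cross n f e := by
  have : NeZero n := ⟨hn⟩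
  obtain ⟨a, b, c, d, rfl, rfl, h1, h2, h3⟩ := h
  refine ⟨c, d, b, a, rfl, Sym2.eq_swap, ?_⟩
  have hd := ZMod.val_lt (d - a)
  rw [val_sub_eq_ite b c a, val_sub_eq_ite d c a, val_sub_eq_ite a c a, sub_self, ZMod.val_zero]
  split_ifs <;> omega

/-- A diagonal through `i` crosses the ear-cover of `i`. -/
lemma cross_earCover_of_mem {n : ℕ} (hn : 5 ≤ n) {i : ZMod n} {e : Sym2 (ZMod n)}
    (he : IsDiagonal n e) (h : i ∈ e) : Cross n e s(i - 1, i + 1) := by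
  have : NeZero n := ⟨by omega⟩
  have p := val_add_one_sub_self (by omega : 2 ≤ n) i
  have q := val_sub_one_sub_self (by omega : 2 ≤ n) i
  obtain ⟨a, b, rfl, hab, ⟨c, hc1, hc2⟩, ⟨d, hd1, hd2⟩⟩ := he
  rcases Sym2.mem_iff.1 h with rfl | rfl
  · refine ⟨i, b, i + 1, i - 1, rfl, Sym2.eq_swap, ?_⟩
    have hb := ZMod.val_lt (b - i)
    rw [val_sub_eq_ite d b i] at hd1 hd2
    rw [val_sub_eq_ite i b i, sub_self, ZMod.val_zero] at hd2
    have := ZMod.val_lt (d - i)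
    rw [p, q]
    split_ifs at * <;> omega
  · refine ⟨i, a, i + 1, i - 1, Sym2.eq_swap, Sym2.eq_swap, ?_⟩
    have ha := ZMod.val_lt (a - i)
    rw [val_sub_eq_ite c a i] at hc1 hc2
    rw [val_sub_eq_ite i a i, sub_self, ZMod.val_zero] at hc2
    have := ZMod.val_lt (c - i)
    rw [p, q]
    split_ifs at * <;> omega

lemma isDiagonal_earCover {n : ℕ} (hn : 5 ≤ n) (i : ZMod n) : IsDiagonal n s(i - 1, i + 1) := by
  have : NeZero n := ⟨by omega⟩
  have p := val_add_one_sub_self (by omega : 2 ≤ n) i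
  have q := val_sub_one_sub_self (by omega : 2 ≤ n) i
  have r := val_add_one_sub_self (by omega : 2 ≤ n) (i + 1)
  refine ⟨i - 1, i + 1, rfl, ?_, ⟨i, ?_⟩, ⟨i + 1 + 1, ?_⟩⟩
  · rw [Ne, eq_iff_val_sub_eq _ _ i, p, q]
    omega
  · unfold Btw
    rw [val_sub_eq_ite i _ i, val_sub_eq_ite (i + 1) _ i, sub_self, ZMod.val_zero, p, q]
    split_ifs <;> omega
  · unfold Btw
    rw [r, val_sub_eq_ite (i - 1) _ i, p, q]
    split_ifs <;> omega

/-- A nonempty open arc from `a` to `b` contains a vertex other than `i`, unless `s(a, b)` is the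
ear-cover of `i`. -/
lemma exists_ne_btw {n : ℕ} (hn : 5 ≤ n) {a b c i : ZMod n} (hb : b ≠ i)
    (hc : Btw n a c b) (hab : s(a, b) ≠ s(i - 1, i + 1)) : ∃ c', c' ≠ i ∧ Btw n a c' b := by
  have : NeZero n := ⟨by omega⟩
  by_cases hci : c = i
  · subst hci
    have p := val_add_one_sub_self (by omega : 2 ≤ n) c
    have q := val_sub_one_sub_self (by omega : 2 ≤ n) c
    obtain ⟨h1, h2⟩ := hc
    have ha' := ZMod.val_lt (a - c)
    have hb' := ZMod.val_lt (b - c)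
    rw [Ne, eq_iff_val_sub_eq _ _ c, sub_self, ZMod.val_zero] at hb
    rw [val_sub_eq_ite c a c, sub_self, ZMod.val_zero] at h1 h2
    rw [val_sub_eq_ite b a c] at h2
    by_cases hac : a = c - 1
    · have hbc : b ≠ c + 1 := fun h => hab (by rw [hac, h])
      rw [Ne, eq_iff_val_sub_eq _ _ c, p] at hbc
      rw [eq_iff_val_sub_eq _ _ c, q] at hac
      refine ⟨c + 1, ?_, ?_⟩
      · rw [Ne, eq_iff_val_sub_eq _ _ c, p, sub_self, ZMod.val_zero]
        omega
      · unfold Btw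
        rw [val_sub_eq_ite (c + 1) a c, val_sub_eq_ite b a c, p]
        split_ifs at * <;> omega
    · rw [eq_iff_val_sub_eq _ _ c, q] at hac
      refine ⟨c - 1, ?_, ?_⟩
      · rw [Ne, eq_iff_val_sub_eq _ _ c, q, sub_self, ZMod.val_zero]
        omega
      · unfold Btw
        rw [val_sub_eq_ite (c - 1) a c, val_sub_eq_ite b a c, q]
        split_ifs at * <;> omega
  · exact ⟨c, hci, hc⟩

lemma IsDiagonalOn.isDiagonal {n : ℕ} {S : Finset (ZMod n)} {e : Sym2 (ZMod n)}
    (h : IsDiagonalOn n S e) : IsDiagonal n e := by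
  obtain ⟨a, b, rfl, -, -, hab, ⟨c, -, hc⟩, ⟨d, -, hd⟩⟩ := h
  exact ⟨a, b, rfl, hab, ⟨c, hc⟩, ⟨d, hd⟩⟩

/-- Adding the ear-cover of `i` to a triangulation of the polygon without `i` triangulates the
whole polygon. -/
lemma IsTriangulationOn.insert_earCover {n : ℕ} (hn : 5 ≤ n) {i : ZMod n} {S : Finset (ZMod n)}
    (hS : ∀ v, v ∈ S ↔ v ≠ i) {T : Finset (Sym2 (ZMod n))} (hT : IsTriangulationOn n S T) :
    IsTriangulation n (insert s(i - 1, i + 1) T) := by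
  have hn0 : n ≠ 0 := by omega
  obtain ⟨hdiag, hcross, hmax⟩ := hT
  have not_mem_earCover : i ∉ s(i - 1, i + 1) := by
    have : NeZero n := ⟨hn0⟩
    have p := val_add_one_sub_self (by omega : 2 ≤ n) i
    have q := val_sub_one_sub_self (by omega : 2 ≤ n) i
    rw [Sym2.mem_iff, eq_iff_val_sub_eq i (i - 1) i, eq_iff_val_sub_eq i (i + 1) i, p, q,
      sub_self, ZMod.val_zero]
    omega
  have not_mem : ∀ e ∈ insert s(i - 1, i + 1) T, i ∉ e := by
    intro e he
    rcases mem_insert.1 he with rfl | he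
    · exact not_mem_earCover
    · obtain ⟨a, b, rfl, ha, hb, -⟩ := hdiag e he
      rw [Sym2.mem_iff, not_or]
      exact ⟨((hS a).1 ha).symm, ((hS b).1 hb).symm⟩
  refine ⟨?_, ?_, ?_⟩
  · intro e he
    rcases mem_insert.1 he with rfl | he
    · exact isDiagonal_earCover hn i
    · exact (hdiag e he).isDiagonal
  · intro e he f hf h
    rcases mem_insert.1 hf with rfl | hf'
    · exact not_mem e he (mem_of_cross_earCover hn h)
    rcases mem_insert.1 he with rfl | he'
    · exact not_mem f hf (mem_of_cross_earCover hn (cross_symm hn0 h))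
    · exact hcross e he' f hf' h
  · intro e he heT
    rw [mem_insert, not_or] at heT
    by_cases hie : i ∈ e
    · exact ⟨_, mem_insert_self _ _, cross_earCover_of_mem hn he hie⟩
    · have heS : IsDiagonalOn n S e := by
        obtain ⟨a, b, rfl, hab, ⟨c, hc⟩, ⟨d, hd⟩⟩ := he
        rw [Sym2.mem_iff, not_or] at hie
        obtain ⟨c', hc', hc'b⟩ := exists_ne_btw hn (Ne.symm hie.2) hc heT.1
        obtain ⟨d', hd', hd'b⟩ := exists_ne_btw hn (Ne.symm hie.1) hd
          (by rw [Sym2.eq_swap]; exact heT.1)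
        exact ⟨a, b, rfl, (hS a).2 (Ne.symm hie.1), (hS b).2 (Ne.symm hie.2), hab,
          ⟨c', (hS c').2 hc', hc'b⟩, ⟨d', (hS d').2 hd', hd'b⟩⟩
      obtain ⟨f, hf, hef⟩ := hmax e heS heT.2
      exact ⟨f, mem_insert_of_mem hf, hef⟩

end ConvexBlocker

open ConvexBlocker in
/-- if the ear-cover `{i-1,i+1}` does not belong to a saturated blocker `B` of
size `n-1` and `deg_B(i) = 2`, then `B∖{i}` is a blocker of the `(n-1)`-gon `C∖{i}` with
exactly `n-3` edges. -/
theorem deleted_vertex_gives_minimum_blocker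
    (n : ℕ) (hn : 5 ≤ n) (B : Finset (Sym2 (ZMod n)))
    (hB : IsSaturatedBlocker n B) (hcard : B.card = n - 1)
    (i : ZMod n) (hi : s(i - 1, i + 1) ∉ B) (hdeg : degB n B i = 2) :
    IsBlockerOn n (((Finset.range n).image (fun j : ℕ => (j : ZMod n))).erase i)
        ((B.filter (fun e => i ∉ e)).erase s(i - 1, i + 1)) ∧
      ((B.filter (fun e => i ∉ e)).erase s(i - 1, i + 1)).card = n - 3 := by
  have : NeZero n := ⟨by omega⟩
  have hS : ∀ v, v ∈ ((Finset.range n).image (fun j : ℕ => (j : ZMod n))).erase i ↔ v ≠ i := by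
    intro v
    rw [mem_erase, and_iff_left]
    exact mem_image.2 ⟨v.val, mem_range.2 v.val_lt, ZMod.natCast_rightInverse v⟩
  have hnot : s(i - 1, i + 1) ∉ B.filter (fun e => i ∉ e) := fun h => hi (mem_of_mem_filter _ h)
  rw [erase_eq_of_notMem hnot]
  refine ⟨⟨?_, ?_⟩, ?_⟩
  · intro e he
    obtain ⟨heB, hie⟩ := mem_filter.1 he
    obtain ⟨a, b, rfl, hab⟩ := hB.1.1 e heB
    rw [Sym2.mem_iff, not_or] at hie
    exact ⟨a, b, rfl, (hS a).2 (Ne.symm hie.1), (hS b).2 (Ne.symm hie.2), hab⟩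
  · intro T hT
    obtain ⟨e, he⟩ := hB.1.2 _ (hT.insert_earCover hn hS)
    obtain ⟨heB, heT⟩ := mem_inter.1 he
    rcases mem_insert.1 heT with rfl | heT
    · exact absurd heB hi
    · refine ⟨e, mem_inter.2 ⟨mem_filter.2 ⟨heB, ?_⟩, heT⟩⟩
      obtain ⟨a, b, rfl, ha, hb, -⟩ := hT.1 e heT
      rw [Sym2.mem_iff, not_or]
      exact ⟨((hS a).1 ha).symm, ((hS b).1 hb).symm⟩
  · have h := card_filter_add_card_filter_not (s := B) (fun e => i ∈ e)
    unfold degB at hdeg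
    omega
end
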